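/- For n ≥ 2 and η ≥ 1, if p ≥ min{1, ((2η+2) log n + 2)/(n−1)}, then the Erdős–Rényi random graph G(n,p) (with self-loops also included independently with probability p) is connected and contains at least one self-loop (hence is non-bipartite) with probability at least 1 − (3/2)n^{−η}. -/

import Mathlib

open scoped Classical

/-- Probability of an event in the product Bernoulli(p) measure on configurations
`α → Bool` (each coordinate independently `true` with probability `p`). -/
noncomputable def pr {α : Type*} [Fintype α] (p : ℝ) (A : Set (α → Bool)) : ℝ :=
  ∑ ω ∈ Finset.univ.filter (fun ω => ω ∈ A), ∏ e : α, (if ω e = true then p else 1 - p)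

/-- The Erdős–Rényi random graph determined by a configuration of edge indicators
indexed by unordered pairs; `ω s(i,i)` records a self-loop at `i`. -/
def erGraph (n : ℕ) (ω : Sym2 (Fin n) → Bool) : SimpleGraph (Fin n) :=
  SimpleGraph.fromRel (fun i j => ω s(i, j) = true)


lemma aux_sum_prod {α : Type*} [Fintype α] (f : α → Bool → ℝ) :
    ∑ ω : α → Bool, ∏ e : α, f e (ω e) = ∏ e : α, (f e true + f e false) := by
  have h := Finset.prod_univ_sum (fun _ : α => (Finset.univ : Finset Bool)) f
  simp only [Fintype.piFinset_univ, Fintype.sum_bool] at h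
  exact h.symm

lemma aux_pr_eq {α : Type*} [Fintype α] (p : ℝ) (A : Set (α → Bool)) :
    pr p A = ∑ ω : α → Bool, (∏ e : α, (if ω e = true then p else 1 - p)) *
      (if ω ∈ A then 1 else 0) := by
  unfold pr
  rw [Finset.sum_filter]
  apply Finset.sum_congr rfl
  intro ω _
  split_ifs <;> simp

lemma aux_pr_zero {α : Type*} [Fintype α] (p : ℝ) (T : Finset α) :
    pr p {ω : α → Bool | ∀ e ∈ T, ω e = false} = (1 - p) ^ T.card := by
  have h := aux_sum_prod (fun (e : α) (b : Bool) =>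
    (if b = true then p else 1 - p) * (if e ∈ T ∧ b = true then (0 : ℝ) else 1))
  rw [aux_pr_eq]
  have h2 : ∀ ω : α → Bool, (if ω ∈ {ω : α → Bool | ∀ e ∈ T, ω e = false} then (1 : ℝ) else 0)
      = ∏ e : α, (if e ∈ T ∧ ω e = true then (0 : ℝ) else 1) := by
    intro ω
    by_cases hω : ∀ e ∈ T, ω e = false
    · rw [if_pos (by exact hω)]
      symm
      apply Finset.prod_eq_one
      intro e _
      rw [if_neg]
      rintro ⟨h1, h3⟩
      simp [hω e h1] at h3
    · rw [if_neg (by exact hω)]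
      push Not at hω
      obtain ⟨e, he, h3⟩ := hω
      symm
      apply Finset.prod_eq_zero (Finset.mem_univ e)
      rw [if_pos]
      exact ⟨he, by simpa using h3⟩
  refine Eq.trans (Finset.sum_congr rfl (fun ω _ => ?_)) (h.trans ?_)
  · rw [Finset.prod_mul_distrib, ← h2 ω]
    congr
  have h4 : ∀ e : α, ((if true = true then p else 1 - p) *
      (if e ∈ T ∧ true = true then (0 : ℝ) else 1) + (if false = true then p else 1 - p) *
      (if e ∈ T ∧ false = true then (0 : ℝ) else 1)) = if e ∈ T then 1 - p else 1 := by
    intro e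
    by_cases he : e ∈ T <;> simp [he]
  rw [Finset.prod_congr rfl (fun e _ => h4 e)]
  simp [Finset.prod_ite_mem]

lemma aux_union {α ι : Type*} [Fintype α] (p : ℝ) (hp0 : 0 ≤ p) (hp1 : p ≤ 1)
    (G L : Set (α → Bool)) (F : Finset ι) (C : ι → Set (α → Bool))
    (h : ∀ ω, ω ∈ G ∨ ω ∈ L ∨ ∃ i ∈ F, ω ∈ C i) :
    1 ≤ pr p G + pr p L + ∑ i ∈ F, pr p (C i) := by
  have h1 : (1 : ℝ) = ∑ ω : α → Bool, ∏ e : α, (if ω e = true then p else 1 - p) := by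
    rw [aux_sum_prod (fun (e : α) (b : Bool) => if b = true then p else 1 - p)]
    simp
  simp only [aux_pr_eq]
  rw [Finset.sum_comm, ← Finset.sum_add_distrib, ← Finset.sum_add_distrib]
  nth_rewrite 1 [h1]
  apply Finset.sum_le_sum
  intro ω _
  rw [← Finset.mul_sum, ← mul_add, ← mul_add]
  have hw : 0 ≤ ∏ e : α, (if ω e = true then p else 1 - p) := by
    apply Finset.prod_nonneg
    intro e _
    split_ifs <;> linarith
  apply le_mul_of_one_le_right hw
  have e1 : (0 : ℝ) ≤ if ω ∈ G then 1 else 0 := by split_ifs <;> norm_num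
  have e2 : (0 : ℝ) ≤ if ω ∈ L then 1 else 0 := by split_ifs <;> norm_num
  have e3 : ∀ i ∈ F, (0 : ℝ) ≤ if ω ∈ C i then 1 else 0 := by
    intro i _; split_ifs <;> norm_num
  have e4 := Finset.sum_nonneg e3
  rcases h ω with h | h | ⟨i, hi, h⟩
  · rw [if_pos h] at e1 ⊢; linarith
  · rw [if_pos h] at e2 ⊢; linarith
  · have := Finset.single_le_sum e3 hi
    rw [if_pos h] at this
    linarith

/-- edges between `S` and its complement -/
noncomputable def auxCut {n : ℕ} (S : Finset (Fin n)) : Finset (Sym2 (Fin n)) :=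
  (S ×ˢ Sᶜ).image (fun x => s(x.1, x.2))

lemma auxCut_card {n : ℕ} (S : Finset (Fin n)) :
    (auxCut S).card = S.card * (n - S.card) := by
  unfold auxCut
  rw [Finset.card_image_of_injOn]
  · simp [Finset.card_product, Finset.card_compl]
  · rintro ⟨a, b⟩ h1 ⟨c, d⟩ h2 h
    simp only [Finset.coe_product, Set.mem_prod, Finset.mem_coe, Finset.mem_compl] at h1 h2
    simp only [Sym2.eq_iff] at h
    rcases h with ⟨rfl, rfl⟩ | ⟨rfl, rfl⟩
    · rfl
    · exact absurd h1.1 h2.2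

lemma aux_disc {n : ℕ} (hn : 2 ≤ n) (ω : Sym2 (Fin n) → Bool) (h : ¬ (erGraph n ω).Connected) :
    ∃ S : Finset (Fin n), S.Nonempty ∧ 2 * S.card ≤ n ∧ ∀ e ∈ auxCut S, ω e = false := by
  have : Nonempty (Fin n) := ⟨⟨0, by omega⟩⟩
  rw [SimpleGraph.connected_iff] at h
  have h : ¬ (erGraph n ω).Preconnected := fun h' => h ⟨h', inferInstance⟩
  unfold SimpleGraph.Preconnected at h
  push Not at h
  obtain ⟨u, v, huv⟩ := h
  set S : Finset (Fin n) := Finset.univ.filter (fun w => (erGraph n ω).Reachable u w) with hS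
  have key : ∀ a ∈ S, ∀ b ∉ S, ω s(a, b) = false := by
    intro a ha b hb
    by_contra hc
    simp only [hS, Finset.mem_filter, Finset.mem_univ, true_and] at ha hb
    apply hb
    refine ha.trans (SimpleGraph.Adj.reachable ?_)
    unfold erGraph
    rw [SimpleGraph.fromRel_adj]
    refine ⟨?_, Or.inl (by simpa using hc)⟩
    rintro rfl
    exact hb ha
  have hu : u ∈ S := by simp [hS]
  have hv : v ∉ S := by simpa [hS] using huv
  have hc : S.card + Sᶜ.card = n := by simpa using Finset.card_add_card_compl S
  by_cases h2 : 2 * S.card ≤ n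
  · refine ⟨S, ⟨u, hu⟩, h2, ?_⟩
    intro e he
    simp only [auxCut, Finset.mem_image, Finset.mem_product, Finset.mem_compl] at he
    obtain ⟨⟨a, b⟩, ⟨h3, h4⟩, rfl⟩ := he
    exact key a h3 b h4
  · refine ⟨Sᶜ, ⟨v, by simpa using hv⟩, by omega, ?_⟩
    intro e he
    simp only [auxCut, Finset.mem_image, Finset.mem_product, Finset.mem_compl, not_not] at he
    obtain ⟨⟨a, b⟩, ⟨h3, h4⟩, rfl⟩ := he
    rw [Sym2.eq_swap]
    exact key b h4 a h3

lemma aux_pow (n : ℕ) (hn : 2 ≤ n) (η p : ℝ) (hη : 1 ≤ η) (hp1 : p ≤ 1)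
    (hp : min 1 (((2 * η + 2) * Real.log n + 2) / ((n : ℝ) - 1)) ≤ p)
    (k m : ℕ) (hm : 0 < m) (hkm : (k : ℝ) * ((n : ℝ) - 1) ≤ 2 * m) :
    (1 - p) ^ m ≤ (Real.exp (-((η + 1) * Real.log n + 1))) ^ k := by
  rcases min_le_iff.1 hp with h | h
  · have : p = 1 := le_antisymm hp1 h
    rw [this, sub_self, zero_pow hm.ne']
    positivity
  · have hn' : (2 : ℝ) ≤ n := by exact_mod_cast hn
    rw [div_le_iff₀ (by linarith)] at h
    have hlog : 0 ≤ Real.log n := Real.log_nonneg (by linarith)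
    have hp0 : 0 ≤ p := by
      by_contra hneg
      push Not at hneg
      nlinarith [mul_nonneg (by linarith : 0 ≤ 2 * η + 2) hlog]
    calc (1 - p) ^ m ≤ (Real.exp (-p)) ^ m := by
          apply pow_le_pow_left₀ (by linarith)
          have := Real.add_one_le_exp (-p)
          linarith
      _ = Real.exp (m * (-p)) := (Real.exp_nat_mul _ _).symm
      _ ≤ Real.exp (k * (-((η + 1) * Real.log n + 1))) := by
          apply Real.exp_le_exp.2
          have h1 := mul_le_mul_of_nonneg_left h (Nat.cast_nonneg (α := ℝ) k)
          have h2 := mul_le_mul_of_nonneg_left hkm hp0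
          nlinarith
      _ = _ := Real.exp_nat_mul _ _

/-- For `n ≥ 2`, `η ≥ 1` and `p ≥ min{1, ((2η+2) log n + 2)/(n−1)}`, the random graph
`G(n,p)` (with self-loops included independently with probability `p`) is connected and
has at least one self-loop (hence is non-bipartite) with probability at least
`1 − (3/2) n^{−η}`. -/
theorem stmt_4 (n : ℕ) (hn : 2 ≤ n) (η p : ℝ) (hη : 1 ≤ η)
    (hp0 : 0 ≤ p) (hp1 : p ≤ 1)
    (hp : min 1 (((2 * η + 2) * Real.log n + 2) / ((n : ℝ) - 1)) ≤ p) :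
    1 - (3 / 2) * (n : ℝ) ^ (-η)
      ≤ pr p {ω : Sym2 (Fin n) → Bool |
          (erGraph n ω).Connected ∧ ∃ i : Fin n, ω s(i, i) = true} := by
  have hn' : (2 : ℝ) ≤ n := by exact_mod_cast hn
  set x : ℝ := Real.exp (-((η + 1) * Real.log n + 1)) with hx
  set q : ℝ := (n : ℝ) ^ (-η) with hq
  have hx0 : 0 < x := Real.exp_pos _
  have hq0 : 0 < q := Real.rpow_pos_of_pos (by linarith) _
  have hq1 : q ≤ 1 / 2 := by
    calc q ≤ (n : ℝ) ^ (-1 : ℝ) := Real.rpow_le_rpow_of_exponent_le (by linarith) (by linarith)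
      _ = 1 / n := by rw [Real.rpow_neg_one, one_div]
      _ ≤ 1 / 2 := by gcongr
  have hnx : n * x = q * Real.exp (-1) := by
    have h1 : (n : ℝ) = Real.exp (Real.log n) := (Real.exp_log (by linarith)).symm
    rw [hq, Real.rpow_def_of_pos (by linarith), hx]
    nth_rewrite 1 [h1]
    rw [← Real.exp_add, ← Real.exp_add]
    congr 1
    ring
  have he : Real.exp (-1) ≤ 1 / 2 := by
    rw [Real.exp_neg, inv_eq_one_div]
    have := Real.add_one_le_exp (1 : ℝ)
    apply one_div_le_one_div_of_le <;> linarith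
  have hnxq : n * x ≤ q / 2 := by rw [hnx]; nlinarith
  set F : Finset (Finset (Fin n)) :=
    Finset.univ.filter (fun S => S.Nonempty ∧ 2 * S.card ≤ n) with hF
  set D : Finset (Sym2 (Fin n)) := Finset.univ.image (fun i : Fin n => s(i, i)) with hD
  have hDc : D.card = n := by
    rw [hD, Finset.card_image_of_injective]
    · simp
    · intro a b h
      simpa [Sym2.eq_iff] using h
  have hU := aux_union p hp0 hp1 {ω : Sym2 (Fin n) → Bool |
          (erGraph n ω).Connected ∧ ∃ i : Fin n, ω s(i, i) = true}
      {ω | ∀ e ∈ D, ω e = false} F (fun S => {ω | ∀ e ∈ auxCut S, ω e = false}) (by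
    intro ω
    by_cases h1 : (erGraph n ω).Connected
    · by_cases h2 : ∃ i : Fin n, ω s(i, i) = true
      · exact Or.inl ⟨h1, h2⟩
      · right; left
        push Not at h2
        intro e he
        simp only [hD, Finset.mem_image, Finset.mem_univ, true_and] at he
        obtain ⟨i, rfl⟩ := he
        simpa using h2 i
    · right; right
      obtain ⟨S, a, b, c⟩ := aux_disc hn ω h1
      exact ⟨S, by simp [hF, a, b], c⟩)
  have hL : pr p {ω : Sym2 (Fin n) → Bool | ∀ e ∈ D, ω e = false} ≤ x := by
    rw [aux_pr_zero, hDc]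
    have := aux_pow n hn η p hη hp1 hp 1 n (by omega) (by push_cast; linarith)
    rwa [pow_one] at this
  have hS : ∑ S ∈ F, pr p {ω : Sym2 (Fin n) → Bool | ∀ e ∈ auxCut S, ω e = false}
      ≤ (1 + x) ^ n - 1 := by
    have h1 : ∑ S : Finset (Fin n), x ^ S.card = (1 + x) ^ n := by
      have := Fintype.sum_pow_mul_eq_add_pow (Fin n) x 1
      simpa [add_comm] using this
    have h2 : ∑ S ∈ Finset.univ.erase (∅ : Finset (Fin n)), x ^ S.card = (1 + x) ^ n - 1 := by
      rw [← h1, ← Finset.sum_erase_add _ _ (Finset.mem_univ (∅ : Finset (Fin n)))]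
      simp
    rw [← h2]
    calc _ ≤ ∑ S ∈ F, x ^ S.card := by
          apply Finset.sum_le_sum
          intro S hS
          simp only [hF, Finset.mem_filter, Finset.mem_univ, true_and] at hS
          obtain ⟨a, b⟩ := hS
          have a' := Finset.card_pos.2 a
          rw [aux_pr_zero, auxCut_card]
          apply aux_pow n hn η p hη hp1 hp
          · apply Nat.mul_pos a'; omega
          · have hle : S.card ≤ n := by omega
            rw [Nat.cast_mul, Nat.cast_sub hle]
            have b' : 2 * (S.card : ℝ) ≤ n := by exact_mod_cast b
            have : (0 : ℝ) ≤ S.card := by positivity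
            nlinarith
      _ ≤ _ := by
          apply Finset.sum_le_sum_of_subset_of_nonneg
          · intro S hS
            simp only [hF, Finset.mem_filter, Finset.mem_univ, true_and] at hS
            simp [hS.1.ne_empty]
          · intros; positivity
  have hE : (1 + x) ^ n ≤ 1 + n * x + (n * x) ^ 2 := by
    have h1 : (1 + x) ^ n ≤ Real.exp (n * x) := by
      rw [Real.exp_nat_mul]
      apply pow_le_pow_left₀ (by linarith)
      have := Real.add_one_le_exp x
      linarith
    have hnx0 : 0 ≤ n * x := by positivity
    have h2 := Real.abs_exp_sub_one_sub_id_le (x := n * x)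
      (by rw [abs_of_nonneg hnx0]; linarith)
    have := (abs_le.1 h2).2
    linarith
  have hx2 : x ≤ n * x := by nlinarith
  have hnx0 : 0 ≤ n * x := by positivity
  have : (n * x) ^ 2 ≤ n * x := by nlinarith
  linarith
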